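/- For every ε > 0, the squared norm of a random matrix product state concentrates around unity: Pr_{ψ ∼ μ_{d,n,D}} (|⟨ψ|ψ⟩ − 1| ≥ ε) ≤ ε^{−2} d^{−n}. -/

import Mathlib

open MeasureTheory Matrix
open scoped ComplexConjugate

noncomputable section

instance matrixMeasurableSpace {m n : Type*} : MeasurableSpace (Matrix m n ℂ) :=
  MeasurableSpace.pi

/-- The site tensor `A^{(m)}_i = (⟨i| ⊗ 1_D) U (|0⟩ ⊗ 1_D)`. -/
def siteMat (d D : ℕ) [NeZero d] (U : Matrix.unitaryGroup (Fin d × Fin D) ℂ) (i : Fin d) :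
    Matrix (Fin D) (Fin D) ℂ :=
  Matrix.of fun a b => (U : Matrix (Fin d × Fin D) (Fin d × Fin D) ℂ) (i, a) (0, b)

/-- The (unnormalized) matrix product state `ψ`, with periodic boundary conditions:
`ψ(i₁,…,iₙ) = Tr[A^{(1)}_{i₁} ⋯ A^{(n)}_{iₙ}]`. -/
def mps (d D n : ℕ) [NeZero d] (U : Fin n → Matrix.unitaryGroup (Fin d × Fin D) ℂ) :
    (Fin n → Fin d) → ℂ :=
  fun idx => Matrix.trace (((List.finRange n).map fun m => siteMat d D (U m) (idx m)).prod)


section helpers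

set_option linter.unusedSimpArgs false
set_option linter.unusedSectionVars false

def BM {Ω : Type*} [MeasurableSpace Ω] (f : Ω → ℂ) : Prop :=
  Measurable f ∧ ∃ C : ℝ, ∀ x, ‖f x‖ ≤ C

lemma BM.mul {Ω : Type*} [MeasurableSpace Ω] {f g : Ω → ℂ} (hf : BM f) (hg : BM g) :
    BM (fun x => f x * g x) := by
  obtain ⟨hf, C, hC⟩ := hf
  obtain ⟨hg, C', hC'⟩ := hg
  refine ⟨hf.mul hg, C * C', fun x => ?_⟩
  rw [norm_mul]
  exact mul_le_mul (hC x) (hC' x) (norm_nonneg _) ((norm_nonneg _).trans (hC x))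

lemma BM.conj {Ω : Type*} [MeasurableSpace Ω] {f : Ω → ℂ} (hf : BM f) :
    BM (fun x => conj (f x)) := by
  obtain ⟨hf, C, hC⟩ := hf
  refine ⟨Complex.continuous_conj.measurable.comp hf, C, fun x => ?_⟩
  simpa using hC x

lemma BM.const {Ω : Type*} [MeasurableSpace Ω] (c : ℂ) : BM (fun _ : Ω => c) :=
  ⟨measurable_const, ‖c‖, fun _ => le_rfl⟩

lemma BM.sum {Ω ι : Type*} [MeasurableSpace Ω] (s : Finset ι) {f : ι → Ω → ℂ}
    (hf : ∀ i, BM (f i)) : BM (fun x => ∑ i ∈ s, f i x) := by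
  choose h1 C hC using hf
  refine ⟨Finset.measurable_sum s fun i _ => h1 i, ∑ i ∈ s, C i, fun x => ?_⟩
  exact (norm_sum_le _ _).trans (Finset.sum_le_sum fun i _ => hC i x)

lemma BM.comp {Ω Ω' : Type*} [MeasurableSpace Ω] [MeasurableSpace Ω'] {f : Ω → ℂ} (hf : BM f)
    {g : Ω' → Ω} (hg : Measurable g) : BM (fun x => f (g x)) := by
  obtain ⟨hf, C, hC⟩ := hf
  exact ⟨hf.comp hg, C, fun x => hC _⟩

lemma BM.int {Ω : Type*} [MeasurableSpace Ω] {f : Ω → ℂ} (hf : BM f)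
    (μ : Measure Ω) [IsProbabilityMeasure μ] : Integrable f μ := by
  obtain ⟨hf, C, hC⟩ := hf
  exact Integrable.of_bound hf.aestronglyMeasurable C (Filter.Eventually.of_forall hC)

variable {ι : Type*} [Fintype ι] [DecidableEq ι]

lemma meas_entry (p x : ι) :
    Measurable (fun U : Matrix.unitaryGroup ι ℂ => (U : Matrix ι ι ℂ) p x) := by
  have h : Measurable (fun M : Matrix ι ι ℂ => M p x) :=
    (measurable_pi_apply x).comp (measurable_pi_apply p)
  exact h.comp measurable_subtype_coe

lemma BM.entry (p x : ι) :
    BM (fun U : Matrix.unitaryGroup ι ℂ => (U : Matrix ι ι ℂ) p x) :=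
  ⟨meas_entry p x, 1, fun U => entry_norm_bound_of_unitary U.2 p x⟩

lemma meas_lmul (V : Matrix.unitaryGroup ι ℂ) :
    Measurable (fun U : Matrix.unitaryGroup ι ℂ => V * U) := by
  apply Measurable.subtype_mk
  refine measurable_pi_lambda _ fun p => measurable_pi_lambda _ fun x => ?_
  show Measurable fun U : Matrix.unitaryGroup ι ℂ =>
    ((V : Matrix ι ι ℂ) * (U : Matrix ι ι ℂ)) p x
  simp only [Matrix.mul_apply]
  exact Finset.measurable_sum _ fun i _ => (meas_entry i x).const_mul _

lemma inv_int (μ : Measure (Matrix.unitaryGroup ι ℂ))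
    (hHaar : ∀ V : Matrix.unitaryGroup ι ℂ, μ.map (fun U => V * U) = μ)
    (V : Matrix.unitaryGroup ι ℂ) {f : Matrix.unitaryGroup ι ℂ → ℂ} (hf : BM f) :
    ∫ U, f (V * U) ∂μ = ∫ U, f U ∂μ := by
  conv_rhs => rw [← hHaar V]
  rw [integral_map (meas_lmul V).aemeasurable hf.1.aestronglyMeasurable]

/-- integrand -/
def qd (x y z w p q r s : ι) (U : Matrix.unitaryGroup ι ℂ) : ℂ :=
  (U : Matrix ι ι ℂ) p x * (U : Matrix ι ι ℂ) q y * conj ((U : Matrix ι ι ℂ) r z) *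
    conj ((U : Matrix ι ι ℂ) s w)

lemma BM.qd (x y z w p q r s : ι) : BM (qd x y z w p q r s) :=
  (((BM.entry p x).mul (BM.entry q y)).mul (BM.entry r z).conj).mul (BM.entry s w).conj

def phaseV (k : ι) : Matrix.unitaryGroup ι ℂ :=
  ⟨Matrix.diagonal (fun j => if j = k then Complex.I else 1), by
    rw [Matrix.mem_unitaryGroup_iff, Matrix.star_eq_conjTranspose, Matrix.diagonal_conjTranspose,
      Matrix.diagonal_mul_diagonal, ← Matrix.diagonal_one]
    congr 1
    ext j
    by_cases h : j = k <;> simp [h]⟩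

def permV (σ : Equiv.Perm ι) : Matrix.unitaryGroup ι ℂ :=
  ⟨Matrix.of (fun i j => if σ i = j then 1 else 0), by
    rw [Matrix.mem_unitaryGroup_iff]
    ext i j
    simp [Matrix.mul_apply, Matrix.one_apply, Matrix.star_eq_conjTranspose, apply_ite, eq_comm]⟩

def hhv (p q : ι) : ι → ℂ := fun j => (if j = p then 3/5 else 0) + (if j = q then 4/5 else 0)

lemma hhv_sum (p q : ι) (g : ι → ℂ) : ∑ j, hhv p q j * g j = 3/5 * g p + 4/5 * g q := by
  simp [hhv, add_mul, Finset.sum_add_distrib]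

def hhV (p q : ι) (h : p ≠ q) : Matrix.unitaryGroup ι ℂ :=
  ⟨1 - (2:ℂ) • Matrix.vecMulVec (hhv p q) (hhv p q), by
    have hs : star (hhv p q) = hhv p q := by
      ext j; simp only [hhv, Pi.star_apply]
      split_ifs <;> simp
    have hd : hhv p q ⬝ᵥ hhv p q = 1 := by
      rw [dotProduct, hhv_sum]; simp [hhv, h, h.symm]; norm_num
    rw [Matrix.mem_unitaryGroup_iff, Matrix.star_eq_conjTranspose, Matrix.conjTranspose_sub,
      Matrix.conjTranspose_smul, Matrix.conjTranspose_vecMulVec, hs]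
    simp only [Matrix.conjTranspose_one, sub_mul, mul_sub, one_mul, mul_one, Matrix.smul_mul,
      Matrix.mul_smul, Matrix.vecMulVec_mul_vecMulVec, hd, star_ofNat, one_smul]
    ext i j
    simp
    ring⟩

lemma phaseV_apply (k p x : ι) (U : Matrix.unitaryGroup ι ℂ) :
    ((phaseV k * U : Matrix.unitaryGroup ι ℂ) : Matrix ι ι ℂ) p x =
      (if p = k then Complex.I else 1) * (U : Matrix ι ι ℂ) p x := by
  simp [phaseV, Matrix.diagonal_mul]

lemma permV_apply (σ : Equiv.Perm ι) (p x : ι) (U : Matrix.unitaryGroup ι ℂ) :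
    ((permV σ * U : Matrix.unitaryGroup ι ℂ) : Matrix ι ι ℂ) p x =
      (U : Matrix ι ι ℂ) (σ p) x := by
  simp [permV, Matrix.mul_apply]

lemma hhV_apply (p q : ι) (h : p ≠ q) (x : ι) (U : Matrix.unitaryGroup ι ℂ) :
    ((hhV p q h * U : Matrix.unitaryGroup ι ℂ) : Matrix ι ι ℂ) p x =
      ∑ a : Fin 2, (![7/25, -24/25] a : ℂ) * (U : Matrix ι ι ℂ) (![p, q] a) x := by
  have : ((hhV p q h * U : Matrix.unitaryGroup ι ℂ) : Matrix ι ι ℂ) p x =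
      (U : Matrix ι ι ℂ) p x - 2 * (hhv p q p * ∑ j, hhv p q j * (U : Matrix ι ι ℂ) j x) := by
    simp only [hhV, Submonoid.coe_mul, Matrix.sub_mul, Matrix.one_mul, Matrix.sub_apply, Matrix.smul_mul,
      Matrix.smul_apply, smul_eq_mul]
    rw [Matrix.mul_apply]
    simp only [Matrix.vecMulVec_apply, mul_assoc, Finset.mul_sum]
  rw [this, hhv_sum]
  simp [hhv, h]
  ring

lemma ite01 (P Q : Prop) [Decidable P] [Decidable Q] :
    ((if P then 1 else 0) * (if Q then 1 else 0) : ℂ) = if P ∧ Q then 1 else 0 := by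
  by_cases hP : P <;> by_cases hQ : Q <;> simp [hP, hQ]

lemma dd1 : ∑ p : ι, ∑ q : ι, (if p = q ∧ q = p then (1:ℂ) else 0) = Fintype.card ι := by
  have : ∀ p q : ι, (p = q ∧ q = p) ↔ p = q := fun p q => ⟨fun h => h.1, fun h => ⟨h, h.symm⟩⟩
  simp [this]

lemma dd2 : ∑ p : ι, ∑ q : ι, (1:ℂ) = (Fintype.card ι : ℂ) ^ 2 := by
  simp [sq]

lemma qd_zero (μ : Measure (Matrix.unitaryGroup ι ℂ))
    (hHaar : ∀ V : Matrix.unitaryGroup ι ℂ, μ.map (fun U => V * U) = μ)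
    (x y z w p q r s : ι) (h1 : ¬ (p = r ∧ q = s)) (h2 : ¬ (p = s ∧ q = r)) :
    ∫ U, qd x y z w p q r s U ∂μ = 0 := by
  have key : ∀ k : ι, (if p = k then Complex.I else 1) * (if q = k then Complex.I else 1) *
      (if r = k then -Complex.I else 1) * (if s = k then -Complex.I else 1) *
      ∫ U, qd x y z w p q r s U ∂μ = ∫ U, qd x y z w p q r s U ∂μ := by
    intro k
    conv_rhs => rw [← inv_int μ hHaar (phaseV k) (BM.qd x y z w p q r s)]
    rw [← integral_const_mul]
    congr 1
    ext U
    simp only [qd, phaseV_apply, map_mul, apply_ite conj, Complex.conj_I, map_one]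
    ring
  by_contra h0
  have key' : ∀ k : ι, (if p = k then Complex.I else 1) * (if q = k then Complex.I else 1) *
      (if r = k then -Complex.I else 1) * (if s = k then -Complex.I else 1) = 1 := by
    intro k
    exact mul_right_cancel₀ h0 (by rw [key k, one_mul])
  have e1 : Complex.I ≠ 1 := by intro h; simpa using congrArg Complex.re h
  have e2 : -Complex.I ≠ 1 := by intro h; simpa using congrArg Complex.re h
  have e3 : (-1 : ℂ) ≠ 1 := by norm_num
  by_cases a1 : p = r
  · have b1 : q ≠ s := fun h => h1 ⟨a1, h⟩
    by_cases a2 : q = r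
    · have b2 : p ≠ s := fun h => h2 ⟨h, a2⟩
      have := key' s
      rw [if_neg b2, if_neg b1, if_neg (a1 ▸ b2), if_pos rfl] at this
      simp [e2] at this
    · have := key' q
      rw [if_neg (fun h : p = q => a2 (h.symm.trans a1)), if_pos rfl, if_neg (Ne.symm a2), if_neg (Ne.symm b1)] at this
      simp [e1] at this
  · by_cases a2 : p = s
    · have b2 : q ≠ r := fun h => h2 ⟨a2, h⟩
      have := key' r
      rw [if_neg a1, if_neg b2, if_pos rfl, if_neg (a2 ▸ a1)] at this
      simp [e2] at this
    · have := key' p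
      rw [if_pos rfl, if_neg (Ne.symm a1), if_neg (Ne.symm a2)] at this
      split_ifs at this
      · simp [e3] at this
      · simp [e1] at this

lemma qd_perm (μ : Measure (Matrix.unitaryGroup ι ℂ))
    (hHaar : ∀ V : Matrix.unitaryGroup ι ℂ, μ.map (fun U => V * U) = μ)
    (x y z w p q r s : ι) (σ : Equiv.Perm ι) :
    ∫ U, qd x y z w (σ p) (σ q) (σ r) (σ s) U ∂μ = ∫ U, qd x y z w p q r s U ∂μ := by
  rw [← inv_int μ hHaar (permV σ) (BM.qd x y z w p q r s)]
  simp only [qd, permV_apply]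

lemma qd_rot (μ : Measure (Matrix.unitaryGroup ι ℂ)) [IsProbabilityMeasure μ]
    (hHaar : ∀ V : Matrix.unitaryGroup ι ℂ, μ.map (fun U => V * U) = μ)
    (x y z w p q : ι) (h : p ≠ q) :
    ∫ U, qd x y z w p p p p U ∂μ =
      ∫ U, qd x y z w p q p q U ∂μ + ∫ U, qd x y z w p q q p U ∂μ := by
  have key : ∫ U, qd x y z w p p p p U ∂μ = ∑ a : Fin 2, ∑ b : Fin 2, ∑ c : Fin 2, ∑ e : Fin 2,
      (![7/25, -24/25] a : ℂ) * (![7/25, -24/25] b : ℂ) * (![7/25, -24/25] c : ℂ) *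
      (![7/25, -24/25] e : ℂ) *
      ∫ U, qd x y z w (![p, q] a) (![p, q] b) (![p, q] c) (![p, q] e) U ∂μ := by
    conv_lhs => rw [← inv_int μ hHaar (hhV p q h) (BM.qd x y z w p p p p)]
    have hb : ∀ a b c e : Fin 2, BM (fun U => (![7/25, -24/25] a : ℂ) * (![7/25, -24/25] b : ℂ) *
      (![7/25, -24/25] c : ℂ) * (![7/25, -24/25] e : ℂ) *
      qd x y z w (![p, q] a) (![p, q] b) (![p, q] c) (![p, q] e) U) := fun a b c e =>
        (BM.const _).mul (BM.qd ..)
    simp_rw [← integral_const_mul]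
    have : (fun U => qd x y z w p p p p (hhV p q h * U)) = fun U =>
       ∑ a : Fin 2, ∑ b : Fin 2, ∑ c : Fin 2, ∑ e : Fin 2,
      (![7/25, -24/25] a : ℂ) * (![7/25, -24/25] b : ℂ) * (![7/25, -24/25] c : ℂ) *
      (![7/25, -24/25] e : ℂ) *
      qd x y z w (![p, q] a) (![p, q] b) (![p, q] c) (![p, q] e) U := by
      ext U
      have h7 : conj (7/25 : ℂ) = 7/25 := by
        rw [map_div₀]; exact congrArg₂ _ (Complex.conj_natCast 7) (Complex.conj_natCast 25)
      have h24 : conj (-24/25 : ℂ) = -24/25 := by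
        rw [map_div₀, map_neg]
        exact congrArg₂ _ (congrArg _ (Complex.conj_natCast 24)) (Complex.conj_natCast 25)
      simp only [qd, hhV_apply, Fin.sum_univ_two, Matrix.cons_val_zero, Matrix.cons_val_one,
        map_add, map_mul, h7, h24]
      ring
    rw [this, integral_finsetSum _ fun a _ => (BM.sum _ fun b => BM.sum _ fun c => BM.sum _ fun e => hb a b c e).int μ]
    refine Finset.sum_congr rfl fun a _ => ?_
    rw [integral_finsetSum _ fun b _ => (BM.sum _ fun c => BM.sum _ fun e => hb a b c e).int μ]
    refine Finset.sum_congr rfl fun b _ => ?_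
    rw [integral_finsetSum _ fun c _ => (BM.sum _ fun e => hb a b c e).int μ]
    refine Finset.sum_congr rfl fun c _ => ?_
    rw [integral_finsetSum _ fun e _ => (hb a b c e).int μ]
  have s1 : ∫ U, qd x y z w q q q q U ∂μ = ∫ U, qd x y z w p p p p U ∂μ := by
    simpa using qd_perm μ hHaar x y z w p p p p (Equiv.swap p q)
  have s2 : ∫ U, qd x y z w q p q p U ∂μ = ∫ U, qd x y z w p q p q U ∂μ := by
    simpa using qd_perm μ hHaar x y z w p q p q (Equiv.swap p q)
  have s3 : ∫ U, qd x y z w q p p q U ∂μ = ∫ U, qd x y z w p q q p U ∂μ := by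
    simpa using qd_perm μ hHaar x y z w p q q p (Equiv.swap p q)
  have z := qd_zero μ hHaar x y z w
  simp only [Fin.sum_univ_two, Matrix.cons_val_zero, Matrix.cons_val_one] at key
  rw [z p p p q (by simp [h, h.symm]) (by simp [h, h.symm]), z p p q p (by simp [h, h.symm]) (by simp [h, h.symm]),
    z p p q q (by simp [h, h.symm]) (by simp [h, h.symm]), z p q p p (by simp [h, h.symm]) (by simp [h, h.symm]),
    z p q q q (by simp [h, h.symm]) (by simp [h, h.symm]), z q p p p (by simp [h, h.symm]) (by simp [h, h.symm]),
    z q p q q (by simp [h, h.symm]) (by simp [h, h.symm]), z q q p p (by simp [h, h.symm]) (by simp [h, h.symm]),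
    z q q p q (by simp [h, h.symm]) (by simp [h, h.symm]), z q q q p (by simp [h, h.symm]) (by simp [h, h.symm]),
    s1, s2, s3] at key
  linear_combination (25^4 / (2 * 7^2 * 24^2) : ℂ) * key

lemma exists_perm_pair (p q p' q' : ι) (h : p ≠ q) (h' : p' ≠ q') :
    ∃ σ : Equiv.Perm ι, σ p = p' ∧ σ q = q' := by
  refine ⟨(Equiv.swap p p').trans (Equiv.swap (Equiv.swap p p' q) q'), ?_, ?_⟩
  · simp only [Equiv.trans_apply, Equiv.swap_apply_left]
    apply Equiv.swap_apply_of_ne_of_ne _ h'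
    intro e
    apply h
    apply (Equiv.swap p p').injective
    rw [← e, Equiv.swap_apply_left]
  · simp

lemma qd_form [Nontrivial ι] (μ : Measure (Matrix.unitaryGroup ι ℂ)) [IsProbabilityMeasure μ]
    (hHaar : ∀ V : Matrix.unitaryGroup ι ℂ, μ.map (fun U => V * U) = μ)
    (x y z w : ι) : ∃ α β : ℂ, ∀ p q r s, ∫ U, qd x y z w p q r s U ∂μ =
      α * ((if p = r then 1 else 0) * (if q = s then 1 else 0)) +
      β * ((if p = s then 1 else 0) * (if q = r then 1 else 0)) := by
  obtain ⟨p0, q0, h0⟩ := exists_pair_ne ι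
  refine ⟨∫ U, qd x y z w p0 q0 p0 q0 U ∂μ, ∫ U, qd x y z w p0 q0 q0 p0 U ∂μ, ?_⟩
  intro p q r s
  by_cases hpq : p = q
  · subst hpq
    by_cases h1 : p = r
    · by_cases h2 : p = s
      · subst h1; subst h2
        have := qd_perm μ hHaar x y z w p0 p0 p0 p0 (Equiv.swap p0 p)
        simp only [Equiv.swap_apply_left] at this
        rw [this, qd_rot μ hHaar x y z w p0 q0 h0]
        simp
      · rw [qd_zero μ hHaar _ _ _ _ _ _ _ _ (by tauto) (by tauto)]
        simp [h2]
    · rw [qd_zero μ hHaar _ _ _ _ _ _ _ _ (by tauto) (by tauto)]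
      simp [h1]
  · by_cases h1 : p = r ∧ q = s
    · obtain ⟨rfl, rfl⟩ := h1
      obtain ⟨σ, rfl, rfl⟩ := exists_perm_pair p0 q0 p q h0 hpq
      rw [qd_perm μ hHaar]
      simp [h0]
    · by_cases h2 : p = s ∧ q = r
      · obtain ⟨rfl, rfl⟩ := h2
        obtain ⟨σ, rfl, rfl⟩ := exists_perm_pair p0 q0 p q h0 hpq
        rw [qd_perm μ hHaar]
        simp [h0]
      · rw [qd_zero μ hHaar _ _ _ _ _ _ _ _ h1 h2]
        have e1 : ((if p = r then 1 else 0) * (if q = s then 1 else 0) : ℂ) = 0 := by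
          rw [ite01, if_neg h1]
        have e2 : ((if p = s then 1 else 0) * (if q = r then 1 else 0) : ℂ) = 0 := by
          rw [ite01, if_neg h2]
        rw [e1, e2]; simp

lemma col_orth (U : Matrix.unitaryGroup ι ℂ) (x z : ι) :
    ∑ p, (U : Matrix ι ι ℂ) p x * conj ((U : Matrix ι ι ℂ) p z) = if x = z then 1 else 0 := by
  have h := congrFun (congrFun (Matrix.mem_unitaryGroup_iff'.1 U.2) z) x
  rw [Matrix.mul_apply, Matrix.one_apply] at h
  simp only [eq_comm (a := x)]
  rw [← h]
  refine Finset.sum_congr rfl fun p _ => ?_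
  rw [Matrix.star_apply, mul_comm]; rfl

lemma qd_val [Nontrivial ι] (μ : Measure (Matrix.unitaryGroup ι ℂ)) [IsProbabilityMeasure μ]
    (hHaar : ∀ V : Matrix.unitaryGroup ι ℂ, μ.map (fun U => V * U) = μ)
    (x y z w p q r s : ι) (N : ℂ) (hN : N = Fintype.card ι) (a b : ℂ)
    (ha : a = (if x = z then 1 else 0) * (if y = w then 1 else 0))
    (hb : b = (if x = w then 1 else 0) * (if y = z then 1 else 0)) :
    ∫ U, qd x y z w p q r s U ∂μ =
      (a - b / N) / (N ^ 2 - 1) * ((if p = r then 1 else 0) * (if q = s then 1 else 0)) +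
      (b - a / N) / (N ^ 2 - 1) * ((if p = s then 1 else 0) * (if q = r then 1 else 0)) := by
  obtain ⟨α, β, h⟩ := qd_form μ hHaar x y z w
  have hN2 : (2:ℝ) ≤ Fintype.card ι := by
    exact_mod_cast Fintype.one_lt_card (α := ι)
  have hN0 : N ≠ 0 := by
    rw [hN]; norm_cast; exact Fintype.card_ne_zero
  have hN1 : N ^ 2 - 1 ≠ 0 := by
    rw [hN]
    have : ((Fintype.card ι : ℝ) ^ 2 - 1) ≠ 0 := by nlinarith
    exact_mod_cast this
  have E1 : N ^ 2 * α + N * β = a := by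
    have : ∑ p, ∑ q, ∫ U, qd x y z w p q p q U ∂μ = a := by
      simp_rw [← integral_finsetSum _ (fun q _ => (BM.qd x y z w _ q _ q).int μ)]
      rw [← integral_finsetSum _ (fun p _ => (BM.sum _ fun q => (BM.qd x y z w p q p q)).int μ)]
      have : ∀ U : Matrix.unitaryGroup ι ℂ, ∑ p, ∑ q, qd x y z w p q p q U = a := by
        intro U
        rw [ha, ← col_orth U, ← col_orth U, Finset.sum_mul_sum]
        refine Finset.sum_congr rfl fun p _ => Finset.sum_congr rfl fun q _ => ?_
        simp only [qd]; ring
      simp [this]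
    rw [← this]
    simp only [h]
    simp only [Finset.sum_add_distrib, ← Finset.mul_sum, ite01, and_self, if_true, dd1, dd2, ← hN]
    ring
  have E2 : N * α + N ^ 2 * β = b := by
    have : ∑ p, ∑ q, ∫ U, qd x y z w p q q p U ∂μ = b := by
      simp_rw [← integral_finsetSum _ (fun q _ => (BM.qd x y z w _ q q _).int μ)]
      rw [← integral_finsetSum _ (fun p _ => (BM.sum _ fun q => (BM.qd x y z w p q q p)).int μ)]
      have : ∀ U : Matrix.unitaryGroup ι ℂ, ∑ p, ∑ q, qd x y z w p q q p U = b := by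
        intro U
        rw [hb, ← col_orth U, ← col_orth U, Finset.sum_mul_sum]
        refine Finset.sum_congr rfl fun p _ => Finset.sum_congr rfl fun q _ => ?_
        simp only [qd]; ring
      simp [this]
    rw [← this]
    simp only [h]
    simp only [Finset.sum_add_distrib, ← Finset.mul_sum, ite01, and_self, if_true, dd1, dd2, ← hN]
    ring
  rw [h, ← E1, ← E2]
  congr 1
  · congr 1; field_simp; ring
  · congr 1; field_simp; ring

lemma first_moment [Nontrivial ι] (μ : Measure (Matrix.unitaryGroup ι ℂ)) [IsProbabilityMeasure μ]
    (hHaar : ∀ V : Matrix.unitaryGroup ι ℂ, μ.map (fun U => V * U) = μ)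
    (x z p r : ι) :
    ∫ U : Matrix.unitaryGroup ι ℂ, (U : Matrix ι ι ℂ) p x * conj ((U : Matrix ι ι ℂ) r z) ∂μ =
      (if p = r then 1 else 0) * (if x = z then 1 else 0) / (Fintype.card ι : ℂ) := by
  have hN2 : (2:ℝ) ≤ Fintype.card ι := by
    exact_mod_cast Fintype.one_lt_card (α := ι)
  have hN0 : (Fintype.card ι : ℂ) ≠ 0 := by
    norm_cast; exact Fintype.card_ne_zero
  have hN1 : (Fintype.card ι : ℂ) ^ 2 - 1 ≠ 0 := by
    have : ((Fintype.card ι : ℝ) ^ 2 - 1) ≠ 0 := by nlinarith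
    exact_mod_cast this
  have e : ∀ U : Matrix.unitaryGroup ι ℂ,
      (U : Matrix ι ι ℂ) p x * conj ((U : Matrix ι ι ℂ) r z) = ∑ q, qd x x z x p q r q U := by
    intro U
    have := col_orth U x x
    rw [if_pos rfl] at this
    rw [← mul_one (_ * _), ← this, Finset.mul_sum]
    refine Finset.sum_congr rfl fun q _ => ?_
    simp only [qd]; ring
  simp only [e]
  rw [integral_finsetSum _ (fun q _ => (BM.qd x x z x p q r q).int μ)]
  simp_rw [qd_val μ hHaar x x z x _ _ _ _ _ rfl _ _ rfl rfl]
  rw [Finset.sum_add_distrib, ← Finset.mul_sum, ← Finset.mul_sum]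
  by_cases h1 : p = r
  · subst h1
    by_cases h2 : x = z
    · subst h2
      simp
      field_simp
      ring
    · have h3 : ¬ z = x := fun h => h2 h.symm
      simp [h2, h3]
  · have h3 : ∀ q, ((if p = q then 1 else 0) * (if q = r then 1 else 0) : ℂ) = 0 := by
      intro q
      rw [ite01, if_neg]
      rintro ⟨rfl, h⟩
      exact h1 h
    simp [h1, h3]

end helpers

section helpers2

open scoped Kronecker

lemma sum_list_prod {R : Type*} [Semiring R] (d : ℕ) : ∀ (n : ℕ) (B : Fin n → Fin d → R),
    ∑ x : Fin n → Fin d, (List.ofFn fun m => B m (x m)).prod =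
      (List.ofFn fun m => ∑ i, B m i).prod
  | 0, B => by simp
  | n + 1, B => by
    rw [← (Fin.consEquiv fun _ : Fin (n+1) => Fin d).sum_comp, Fintype.sum_prod_type]
    simp only [List.ofFn_succ, List.prod_cons, Fin.consEquiv_apply, Fin.cons_zero, Fin.cons_succ]
    simp_rw [← Finset.mul_sum]
    rw [sum_list_prod d n, Finset.sum_mul]

lemma kron_list_prod {ι κ : Type*} [Fintype ι] [DecidableEq ι] [Fintype κ] [DecidableEq κ] :
    ∀ (n : ℕ) (A : Fin n → Matrix ι ι ℂ) (B : Fin n → Matrix κ κ ℂ),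
    (List.ofFn A).prod ⊗ₖ (List.ofFn B).prod = (List.ofFn fun m => A m ⊗ₖ B m).prod
  | 0, A, B => by simp
  | n + 1, A, B => by
    simp only [List.ofFn_succ, List.prod_cons]
    rw [Matrix.mul_kronecker_mul, kron_list_prod n]

lemma BM.listprod {Ω ι : Type*} [MeasurableSpace Ω] [Fintype ι] [DecidableEq ι]
    (F : Ω → Matrix ι ι ℂ) (hF : ∀ i j, BM fun ω => F ω i j) :
    ∀ (n : ℕ) (i j : ι), BM fun ω : Fin n → Ω => (List.ofFn fun m => F (ω m)).prod i j
  | 0, i, j => by simpa using BM.const _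
  | n + 1, i, j => by
    simp only [List.ofFn_succ, List.prod_cons, Matrix.mul_apply]
    refine BM.sum _ fun k => ?_
    refine ((hF i k).comp (measurable_pi_apply 0)).mul ?_
    exact (BM.listprod F hF n k j).comp
      (g := fun (ω : Fin (n+1) → Ω) m => ω m.succ)
      (measurable_pi_lambda _ fun m => measurable_pi_apply m.succ)

lemma int_listprod {Ω ι : Type*} [MeasurableSpace Ω] [Fintype ι] [DecidableEq ι]
    (μ : Measure Ω) [IsProbabilityMeasure μ]
    (F : Ω → Matrix ι ι ℂ) (hF : ∀ i j, BM fun ω => F ω i j) (T : Matrix ι ι ℂ)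
    (hT : ∀ i j, ∫ ω, F ω i j ∂μ = T i j) :
    ∀ (n : ℕ) (i j : ι), ∫ ω : Fin n → Ω, (List.ofFn fun m => F (ω m)).prod i j
      ∂(Measure.pi fun _ => μ) = (T ^ n) i j
  | 0, i, j => by simp
  | n + 1, i, j => by
    have hm := (measurePreserving_piFinSuccAbove (fun _ : Fin (n+1) => μ) 0).symm
    rw [← hm.integral_comp (MeasurableEquiv.measurableEmbedding _)]
    have e : ∀ ω : Ω × (Fin n → Ω), (List.ofFn fun m =>
        F (((MeasurableEquiv.piFinSuccAbove (fun _ : Fin (n+1) => Ω) 0).symm ω) m)).prod i j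
        = ∑ k, F ω.1 i k * (List.ofFn fun m => F (ω.2 m)).prod k j := by
      intro ω
      simp only [List.ofFn_succ, List.prod_cons, Matrix.mul_apply]
      simp [MeasurableEquiv.piFinSuccAbove, Fin.insertNthEquiv]
    simp only [e]
    have hb : ∀ k, BM fun ω : Ω × (Fin n → Ω) => F ω.1 i k * (List.ofFn fun m => F (ω.2 m)).prod k j :=
      fun k => ((hF i k).comp measurable_fst).mul ((BM.listprod F hF n k j).comp measurable_snd)
    rw [integral_finsetSum _ fun k _ => (hb k).int _, pow_succ', Matrix.mul_apply]
    refine Finset.sum_congr rfl fun k _ => ?_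
    rw [← int_listprod μ F hF T hT n k j, ← hT i k]
    exact integral_prod_mul (fun ω => F ω i k)
      (fun ω : Fin n → Ω => (List.ofFn fun m => F (ω m)).prod k j)

lemma int_trace {Ω ι : Type*} [MeasurableSpace Ω] [Fintype ι] [DecidableEq ι]
    (μ : Measure Ω) [IsProbabilityMeasure μ]
    (F : Ω → Matrix ι ι ℂ) (hF : ∀ i j, BM fun ω => F ω i j) (T : Matrix ι ι ℂ)
    (hT : ∀ i j, ∫ ω, F ω i j ∂μ = T i j) (n : ℕ) :
    ∫ ω : Fin n → Ω, ((List.ofFn fun m => F (ω m)).prod).trace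
      ∂(Measure.pi fun _ => μ) = (T ^ n).trace := by
  simp only [Matrix.trace, Matrix.diag]
  rw [integral_finsetSum _ fun k _ => (BM.listprod F hF n k k).int _]
  exact Finset.sum_congr rfl fun k _ => int_listprod μ F hF T hT n k k

lemma trace_pow_swap {ι κ : Type*} [Fintype ι] [DecidableEq ι] [Fintype κ] [DecidableEq κ]
    (A : Matrix ι κ ℂ) (B : Matrix κ ι ℂ) (n : ℕ) :
    ((A * B) ^ (n + 1)).trace = ((B * A) ^ (n + 1)).trace := by
  have h : ∀ n : ℕ, (A * B) ^ (n + 1) = A * ((B * A) ^ n * B) := by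
    intro n
    induction n with
    | zero => simp
    | succ n ih => rw [pow_succ', ih, pow_succ' _ n]; simp only [Matrix.mul_assoc]
  rw [h, Matrix.trace_mul_comm, Matrix.mul_assoc, ← pow_succ]

/-- transfer matrix -/
def tm (d D : ℕ) [NeZero d] (U : Matrix.unitaryGroup (Fin d × Fin D) ℂ) :
    Matrix (Fin D × Fin D) (Fin D × Fin D) ℂ :=
  ∑ i, siteMat d D U i ⊗ₖ (siteMat d D U i).map conj

lemma tm_apply (d D : ℕ) [NeZero d] (U : Matrix.unitaryGroup (Fin d × Fin D) ℂ)
    (r c : Fin D × Fin D) : tm d D U r c = ∑ i : Fin d,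
      (U : Matrix (Fin d × Fin D) (Fin d × Fin D) ℂ) (i, r.1) (0, c.1) *
      conj ((U : Matrix (Fin d × Fin D) (Fin d × Fin D) ℂ) (i, r.2) (0, c.2)) := by
  simp [tm, Matrix.sum_apply, siteMat, Matrix.kroneckerMap_apply]

lemma BM.tm (d D : ℕ) [NeZero d] (r c : Fin D × Fin D) : BM fun U => tm d D U r c := by
  simp only [tm_apply]
  exact BM.sum _ fun i => (BM.entry _ _).mul (BM.entry _ _).conj

lemma norm_eq_trace (d D n : ℕ) [NeZero d] (U : Fin n → Matrix.unitaryGroup (Fin d × Fin D) ℂ) :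
    ((∑ x, ‖mps d D n U x‖ ^ 2 : ℝ) : ℂ) = ((List.ofFn fun m => tm d D (U m)).prod).trace := by
  unfold tm
  rw [← sum_list_prod d n (fun m i => siteMat d D (U m) i ⊗ₖ (siteMat d D (U m) i).map conj),
    Matrix.trace_sum]
  push_cast
  refine Finset.sum_congr rfl fun x _ => ?_
  rw [← kron_list_prod, Matrix.trace_kronecker, ← Complex.mul_conj']
  have h1 : mps d D n U x = ((List.ofFn fun m => siteMat d D (U m) (x m)).prod).trace := by
    rw [mps, List.ofFn_eq_map]
  have h2 : ∀ A : Matrix (Fin D) (Fin D) ℂ, conj A.trace = (A.map conj).trace := by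
    intro A; simp [Matrix.trace]
  rw [h1, h2]
  congr 2
  have := map_list_prod ((starRingEnd ℂ).mapMatrix (m := Fin D)) (List.ofFn fun m => siteMat d D (U m) (x m))
  rw [List.map_ofFn] at this
  exact this

/-- the two permutation vectors -/
def Lm (D : ℕ) : Matrix (Fin 2) ((Fin D × Fin D) × (Fin D × Fin D)) ℂ :=
  Matrix.of fun t v => if t = 0 then
    (if v.1.1 = v.1.2 then 1 else 0) * (if v.2.1 = v.2.2 then 1 else 0)
    else (if v.1.1 = v.2.2 then 1 else 0) * (if v.2.1 = v.1.2 then 1 else 0)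

def Cm (d D N : ℂ) : Matrix (Fin 2) (Fin 2) ℂ :=
  !![d ^ 2 / (N ^ 2 - 1), - d ^ 2 / (N * (N ^ 2 - 1)); - d / (N * (N ^ 2 - 1)), d / (N ^ 2 - 1)]

lemma Gm (D : ℕ) : Lm D * (Lm D)ᵀ = !![(D:ℂ) ^ 2, (D:ℂ); (D:ℂ), (D:ℂ) ^ 2] := by
  have h1 : ∑ p : Fin D, ∑ q : Fin D, (1:ℂ) = (D : ℂ) ^ 2 := by simp [sq]
  ext i j
  fin_cases i <;> fin_cases j <;>
  simp [Matrix.mul_apply, Lm, Fintype.sum_prod_type, sq]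

lemma second_moment (d D : ℕ) [NeZero d] (hd : 2 ≤ d) (hD : 2 ≤ D)
    (μ : Measure (Matrix.unitaryGroup (Fin d × Fin D) ℂ)) [IsProbabilityMeasure μ]
    (hHaar : ∀ V : Matrix.unitaryGroup (Fin d × Fin D) ℂ, μ.map (fun U => V * U) = μ)
    (r c : (Fin D × Fin D) × (Fin D × Fin D)) :
    ∫ U, (tm d D U ⊗ₖ tm d D U) r c ∂μ =
      ((Lm D)ᵀ * (Cm d D (d * D) * Lm D)) r c := by
  have : Nontrivial (Fin D) := Fin.nontrivial_iff_two_le.2 hD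
  have : Nontrivial (Fin d × Fin D) := inferInstance
  have e : ∀ U, (tm d D U ⊗ₖ tm d D U) r c = ∑ i : Fin d, ∑ j : Fin d,
      qd ((0 : Fin d), c.1.1) (0, c.2.1) (0, c.1.2) (0, c.2.2)
        (i, r.1.1) (j, r.2.1) (i, r.1.2) (j, r.2.2) U := by
    intro U
    rw [Matrix.kroneckerMap_apply, tm_apply, tm_apply, Finset.sum_mul_sum]
    refine Finset.sum_congr rfl fun p _ => Finset.sum_congr rfl fun q _ => ?_
    simp only [qd]; ring
  simp only [e]
  rw [integral_finsetSum _ fun i _ => (BM.sum _ fun j => BM.qd ..).int μ]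
  simp_rw [integral_finsetSum Finset.univ fun j _ => (BM.qd _ _ _ _ _ (j, _) _ (j, _)).int μ]
  simp_rw [qd_val μ hHaar _ _ _ _ _ _ _ _ (d * D) (by simp) _ _ rfl rfl]
  simp only [Prod.mk.injEq, true_and, Finset.sum_add_distrib, ← Finset.mul_sum]
  have s1 : ((if r.1.1 = r.1.2 then 1 else 0) * ∑ i : Fin d, ∑ j : Fin d, (if r.2.1 = r.2.2 then 1 else 0) : ℂ)
      = (d:ℂ)^2 * Lm D 0 r := by
    simp [Lm, sq]
  have s2 : ∑ i : Fin d, ∑ j : Fin d, ((if i = j ∧ r.1.1 = r.2.2 then 1 else 0) * (if j = i ∧ r.2.1 = r.1.2 then 1 else 0) : ℂ)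
      = (d:ℂ) * Lm D 1 r := by
    have : ∀ i j : Fin d, ((if i = j ∧ r.1.1 = r.2.2 then 1 else 0) * (if j = i ∧ r.2.1 = r.1.2 then 1 else 0) : ℂ)
      = if i = j then Lm D 1 r else 0 := by
      intro i j
      by_cases h : i = j
      · simp [h, Lm]
      · simp [h]
    simp [this]
  rw [s1, s2]
  have l0 : ((if c.1.1 = c.1.2 then 1 else 0) * (if c.2.1 = c.2.2 then 1 else 0) : ℂ) = Lm D 0 c := by
    simp [Lm]
  have l1 : ((if c.1.1 = c.2.2 then 1 else 0) * (if c.2.1 = c.1.2 then 1 else 0) : ℂ) = Lm D 1 c := by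
    simp [Lm]
  rw [l0, l1]
  rw [Matrix.mul_apply]
  simp only [Matrix.mul_apply, Fin.sum_univ_two, Matrix.transpose_apply, Cm, Matrix.of_apply,
    Matrix.cons_val_zero, Matrix.cons_val_one, Matrix.cons_val', Matrix.cons_val_fin_one]
  simp only [div_eq_mul_inv, mul_inv]
  ring

lemma trace_K (d D : ℕ) (hd : 2 ≤ d) (hD : 2 ≤ D) (n : ℕ) :
    ((Cm d D (d * D) * Lm D * (Lm D)ᵀ) ^ n).trace =
      1 + ((d:ℂ) * (D ^ 2 - 1) / (d ^ 2 * D ^ 2 - 1)) ^ n := by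
  have hd' : (2:ℝ) ≤ d := by exact_mod_cast hd
  have hD' : (2:ℝ) ≤ D := by exact_mod_cast hD
  have hd0 : (d:ℂ) ≠ 0 := by norm_cast; omega
  have hD0 : (D:ℂ) ≠ 0 := by norm_cast; omega
  have hN : (d:ℂ) ^ 2 * D ^ 2 - 1 ≠ 0 := by
    have : (d:ℝ) ^ 2 * D ^ 2 - 1 ≠ 0 := by nlinarith [mul_le_mul hd' hD' (by norm_num) (by linarith)]
    exact_mod_cast this
  rw [Matrix.mul_assoc, Gm]
  set lam : ℂ := (d:ℂ) * (D ^ 2 - 1) / (d ^ 2 * D ^ 2 - 1) with hl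
  set K := Cm d D (d * D) * !![(D:ℂ) ^ 2, (D:ℂ); (D:ℂ), (D:ℂ) ^ 2] with hK
  have hKe : K = !![((d:ℂ)^2*D^2 - d) / (d ^ 2 * D ^ 2 - 1), ((d:ℂ)^2*D - d*D) / (d ^ 2 * D ^ 2 - 1);
     ((d:ℂ)*D - D)/ (d ^ 2 * D ^ 2 - 1), ((d:ℂ)*D^2-1)/ (d ^ 2 * D ^ 2 - 1)] := by
    rw [hK, Cm, Matrix.mul_fin_two, mul_pow]
    congr 1
    ext i j
    fin_cases i <;> fin_cases j <;> simp <;> field_simp <;> ring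
  have htr : K.trace = 1 + lam := by
    rw [hKe, hl, Matrix.trace_fin_two_of]; field_simp; ring
  have hsq : K * K = (1 + lam) • K - lam • (1 : Matrix (Fin 2) (Fin 2) ℂ) := by
    rw [hKe, hl, Matrix.mul_fin_two, Matrix.one_fin_two]
    ext i j
    fin_cases i <;> fin_cases j <;> simp <;> field_simp <;> ring
  have main : ∀ n : ℕ, (K ^ n).trace = 1 + lam ^ n ∧ (K ^ (n+1)).trace = 1 + lam ^ (n+1) := by
    intro n
    induction n with
    | zero => simp [htr]; norm_num
    | succ n ih =>
      refine ⟨ih.2, ?_⟩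
      have : K ^ (n + 1 + 1) = (1 + lam) • K ^ (n+1) - lam • K ^ n := by
        rw [pow_succ, pow_succ, mul_assoc, hsq, mul_sub, Matrix.mul_smul, Matrix.mul_smul, mul_one]
      rw [this, Matrix.trace_sub, Matrix.trace_smul, Matrix.trace_smul, ih.1, ih.2]
      simp only [smul_eq_mul]
      ring
  exact (main n).1

lemma E1 (d D n : ℕ) [NeZero d] (hD : 2 ≤ D) (hn : 1 ≤ n)
    (μ : Measure (Matrix.unitaryGroup (Fin d × Fin D) ℂ)) [IsProbabilityMeasure μ]
    (hHaar : ∀ V : Matrix.unitaryGroup (Fin d × Fin D) ℂ, μ.map (fun U => V * U) = μ) :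
    ∫ U : Fin n → Matrix.unitaryGroup (Fin d × Fin D) ℂ,
      ((List.ofFn fun m => tm d D (U m)).prod).trace ∂(Measure.pi fun _ => μ) = 1 := by
  have : Nontrivial (Fin D) := Fin.nontrivial_iff_two_le.2 hD
  have : Nontrivial (Fin d × Fin D) := inferInstance
  have hd0 : (d:ℂ) ≠ 0 := by exact_mod_cast NeZero.ne d
  have hD0 : (D:ℂ) ≠ 0 := by norm_cast; omega
  let A : Matrix (Fin D × Fin D) Unit ℂ := Matrix.of fun v _ => if v.1 = v.2 then 1 else 0
  let B : Matrix Unit (Fin D × Fin D) ℂ := Matrix.of fun _ v => if v.1 = v.2 then (D:ℂ)⁻¹ else 0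
  rw [int_trace μ (tm d D) (BM.tm d D) (A * B)]
  · obtain ⟨n, rfl⟩ := Nat.exists_eq_add_of_le' hn
    rw [trace_pow_swap]
    have : B * A = 1 := by
      ext i j
      simp [A, B, Matrix.mul_apply, Fintype.sum_prod_type, hD0]
    rw [this]; simp
  · intro r c
    simp only [tm_apply]
    rw [integral_finsetSum _ fun i _ => ((BM.entry _ _).mul (BM.entry _ _).conj).int μ]
    simp_rw [first_moment μ hHaar]
    by_cases h1 : r.1 = r.2 <;> by_cases h2 : c.1 = c.2 <;> simp [A, B, Matrix.mul_apply, h1, h2]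
    field_simp

lemma E2 (d D n : ℕ) [NeZero d] (hd : 2 ≤ d) (hD : 2 ≤ D) (hn : 1 ≤ n)
    (μ : Measure (Matrix.unitaryGroup (Fin d × Fin D) ℂ)) [IsProbabilityMeasure μ]
    (hHaar : ∀ V : Matrix.unitaryGroup (Fin d × Fin D) ℂ, μ.map (fun U => V * U) = μ) :
    ∫ U : Fin n → Matrix.unitaryGroup (Fin d × Fin D) ℂ,
      ((List.ofFn fun m => tm d D (U m)).prod).trace ^ 2 ∂(Measure.pi fun _ => μ) =
      1 + ((d:ℂ) * (D ^ 2 - 1) / (d ^ 2 * D ^ 2 - 1)) ^ n := by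
  simp_rw [sq (Matrix.trace _), ← Matrix.trace_kronecker, kron_list_prod]
  rw [int_trace μ (fun U => tm d D U ⊗ₖ tm d D U) (fun i j => (BM.tm d D _ _).mul (BM.tm d D _ _))
    ((Lm D)ᵀ * (Cm d D (d * D) * Lm D)) (second_moment d D hd hD μ hHaar)]
  obtain ⟨n, rfl⟩ := Nat.exists_eq_add_of_le' hn
  rw [trace_pow_swap, trace_K d D hd hD]

end helpers2

/-- concentration of the squared norm of a random MPS around unity:
`Pr(|⟨ψ|ψ⟩ − 1| ≥ ε) ≤ ε^{−2} d^{−n}`, where the `n` site unitaries are drawn i.i.d.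
from the Haar probability measure on `U(dD)` (the unique left-invariant Borel probability
measure on the unitary group). -/
theorem norm_concentration
    (d D n : ℕ) [NeZero d] (hd : 2 ≤ d) (hD : 2 ≤ D) (hn : 1 ≤ n)
    (μ : Measure (Matrix.unitaryGroup (Fin d × Fin D) ℂ)) [IsProbabilityMeasure μ]
    (hHaar : ∀ V : Matrix.unitaryGroup (Fin d × Fin D) ℂ, μ.map (fun U => V * U) = μ)
    (ε : ℝ) (hε : 0 < ε) :
    (Measure.pi fun _ : Fin n => μ)
        {U | ε ≤ |(∑ x, ‖mps d D n U x‖ ^ 2) - 1|}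
      ≤ ENNReal.ofReal (ε⁻¹ ^ 2 * ((d : ℝ) ^ n)⁻¹) := by
  set f : (Fin n → Matrix.unitaryGroup (Fin d × Fin D) ℂ) → ℝ :=
    fun U => ∑ x, ‖mps d D n U x‖ ^ 2 with hf
  set P := Measure.pi fun _ : Fin n => μ with hP
  have hd' : (2:ℝ) ≤ d := by exact_mod_cast hd
  have hD' : (2:ℝ) ≤ D := by exact_mod_cast hD
  have hfc : ∀ U, (f U : ℂ) = ((List.ofFn fun m => tm d D (U m)).prod).trace := norm_eq_trace d D n
  have hB : BM fun U => (f U : ℂ) := by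
    simp only [hfc, Matrix.trace, Matrix.diag]
    exact BM.sum _ fun k => BM.listprod _ (BM.tm d D) n k k
  have i1 : Integrable f P := by
    have := (hB.int P).re
    simpa using this
  have i2 : Integrable (fun U => f U ^ 2) P := by
    have := ((hB.mul hB).int P).re
    simpa [sq] using this
  have e1 : ∫ U, f U ∂P = 1 := by
    have := E1 d D n hD hn μ hHaar
    simp_rw [← hfc] at this
    rw [integral_complex_ofReal] at this
    exact_mod_cast this
  have e2 : ∫ U, f U ^ 2 ∂P = 1 + ((d:ℝ) * (D ^ 2 - 1) / (d ^ 2 * D ^ 2 - 1)) ^ n := by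
    have := E2 d D n hd hD hn μ hHaar
    simp_rw [← hfc, ← Complex.ofReal_pow] at this
    rw [integral_complex_ofReal] at this
    exact_mod_cast this
  have i3 : Integrable (fun U => (f U - 1) ^ 2) P := by
    have := (i2.sub (i1.const_mul 2)).add (integrable_const (1:ℝ))
    refine this.congr (Filter.Eventually.of_forall fun U => ?_)
    simp only [Pi.add_apply, Pi.sub_apply]
    ring
  have e3 : ∫ U, (f U - 1) ^ 2 ∂P = ((d:ℝ) * (D ^ 2 - 1) / (d ^ 2 * D ^ 2 - 1)) ^ n := by
    have : ∀ U, (f U - 1) ^ 2 = f U ^ 2 - 2 * f U + 1 := fun U => by ring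
    simp_rw [this]
    rw [integral_add (f := fun U => f U ^ 2 - 2 * f U) (i2.sub (i1.const_mul 2)) (integrable_const _),
      integral_sub i2 (i1.const_mul 2), integral_const_mul, e1, e2]
    simp
    ring
  have hlam : ((d:ℝ) * (D ^ 2 - 1) / (d ^ 2 * D ^ 2 - 1)) ^ n ≤ ((d:ℝ) ^ n)⁻¹ := by
    rw [← inv_pow]
    have h0 : (0:ℝ) < d ^ 2 * D ^ 2 - 1 := by
      nlinarith [mul_le_mul hd' hD' (by norm_num) (by linarith)]
    apply pow_le_pow_left₀
    · apply div_nonneg _ h0.le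
      apply mul_nonneg <;> nlinarith
    · rw [div_le_iff₀ h0, ← div_eq_inv_mul, le_div_iff₀ (by linarith)]
      nlinarith
  have ch := mul_meas_ge_le_integral_of_nonneg (μ := P)
    (Filter.Eventually.of_forall fun U => sq_nonneg (f U - 1)) i3 (ε ^ 2)
  have hset : {U | ε ≤ |f U - 1|} = {U | ε ^ 2 ≤ (f U - 1) ^ 2} := by
    ext U
    simp only [Set.mem_ofPred_eq]
    rw [← sq_abs (f U - 1)]
    exact (pow_le_pow_iff_left₀ hε.le (abs_nonneg _) (by norm_num)).symm
  rw [hset, ← ofReal_measureReal]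
  apply ENNReal.ofReal_le_ofReal
  rw [e3] at ch
  rw [inv_pow, ← div_eq_inv_mul, le_div_iff₀ (by positivity), mul_comm]
  exact ch.trans hlam
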